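/- Set t_* := 2^{2s+2} s (K+2)^{2s} θ^{2s+1} / (γ [2^{2s} − 1 − 2^{2s+1} s (K+2)^{2s} θ^{2s} (‖σ‖_∞ + δ̂)]). Then there exist K > 1, M > 1 and θ₀ > 0 such that for every θ ∈ (0,θ₀) and every δ̂ ∈ (0,1], the solution (x̂₁, x̂₂, x̂₃) of the three-particle hat system (with initial data x̂₁(0) = p₁ − θ, x̂₂(0) = p₂ + Kθ, x̂₃(0) = p₃ − θ, where p₂ − p₁ = θ and p₃ − p₂ ≥ Mθ) satisfies: t ↦ x̂₂(t) − x̂₁(t) is decreasing for t > 0; x̂₁(t_*) ≥ p₂; and x̂₃(t) − x̂₂(t) ≥ x̂₂(t) − x̂₁(t) ≥ θ for every t ∈ [0,t_*]. -/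

import Mathlib

open Real Filter Set MeasureTheory

noncomputable section

/-- The fractional Laplacian of order `2s` (principal-value form). -/
def fracLap (s : ℝ) (φ : ℝ → ℝ) (x : ℝ) : ℝ :=
  (1/2) * ∫ y : ℝ, (φ (x + y) + φ (x - y) - 2 * φ x) / |y| ^ (1 + 2*s)

/-- Assumptions on the periodic potential `W`. -/
structure IsPotential (W : ℝ → ℝ) : Prop where
  contDiff : ContDiff ℝ 3 W
  holder3 : ∃ C r : NNReal, 0 < (r : ℝ) ∧ (r : ℝ) < 1 ∧ HolderWith C r (iteratedDeriv 3 W)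
  periodic : ∀ v : ℝ, W (v + 1) = W v
  zero_int : ∀ n : ℤ, W (n : ℝ) = 0
  pos_nonint : ∀ v : ℝ, (∀ n : ℤ, v ≠ (n : ℝ)) → 0 < W v
  second_deriv_pos : 0 < deriv (deriv W) 0

/-- The basic layer solution `u`. -/
structure IsLayer (s : ℝ) (W u : ℝ → ℝ) : Prop where
  diff : Differentiable ℝ u
  eqn : ∀ x, fracLap s u x = deriv W (u x)
  deriv_pos : ∀ x, 0 < deriv u x
  lim_bot : Tendsto u atBot (nhds 0)
  lim_top : Tendsto u atTop (nhds 1)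
  half : u 0 = 1/2

/-- Assumptions on the external stress `σ`. -/
structure SigmaOK (s : ℝ) (σ : ℝ → ℝ → ℝ) : Prop where
  bounded : ∃ B : ℝ, ∀ t x : ℝ, 0 ≤ t → |σ t x| ≤ B
  ucont : UniformContinuousOn (fun p : ℝ × ℝ => σ p.1 p.2) (Ici 0 ×ˢ univ)
  deriv_bound : ∃ M : ℝ, 0 < M ∧ ∃ α : ℝ, s < α ∧ α < 1 ∧
    (∀ t x : ℝ, 0 ≤ t →
      |deriv (fun ξ => σ t ξ) x| + |deriv (fun τ => σ τ x) t| ≤ M) ∧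
    (∀ t x h : ℝ, 0 ≤ t →
      |deriv (fun ξ => σ t ξ) (x + h) - deriv (fun ξ => σ t ξ) x| ≤ M * |h| ^ α)

/-- `v` is a bounded pointwise solution of `ε ∂_t v = I_s v − ε^{−2s} W'(v) + σ`
with initial datum `v0`. -/
def SolvesPDE (s ε : ℝ) (W : ℝ → ℝ) (σ : ℝ → ℝ → ℝ) (v0 : ℝ → ℝ) (v : ℝ → ℝ → ℝ) : Prop :=
  (∃ B : ℝ, ∀ t x : ℝ, |v t x| ≤ B) ∧
  (∀ x : ℝ, v 0 x = v0 x) ∧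
  (∀ t : ℝ, 0 < t → ∀ x : ℝ,
    HasDerivAt (fun τ => v τ x)
      ((1/ε) * (fracLap s (v t) x - (1/ε ^ (2*s)) * deriv W (v t x) + σ t x)) t)

/-- The `δ`-perturbed two-particle system with collision time `Tc`
(the case `δ = 0` is the unperturbed one). -/
def TwoPartPert (s γ δ : ℝ) (σ : ℝ → ℝ → ℝ) (x10 x20 Tc : ℝ) (x1 x2 : ℝ → ℝ) : Prop :=
  x1 0 = x10 - δ ∧ x2 0 = x20 + δ ∧
  ContinuousOn x1 (Ico 0 Tc) ∧ ContinuousOn x2 (Ico 0 Tc) ∧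
  (∀ t ∈ Ioo (0:ℝ) Tc,
    HasDerivAt x1 (γ * (1/(2*s*(x2 t - x1 t) ^ (2*s)) - σ t (x1 t) - δ)) t ∧
    HasDerivAt x2 (γ * (-(1/(2*s*(x2 t - x1 t) ^ (2*s))) + σ t (x2 t) + δ)) t) ∧
  (∀ t ∈ Ico (0:ℝ) Tc, x1 t < x2 t) ∧
  Tendsto (fun t => x2 t - x1 t) (nhdsWithin Tc (Iio Tc)) (nhds 0)

/-- Orientations of the three transition layers. -/
def zeta : Fin 3 → ℝ := ![1, -1, 1]

/-- The `δ`-perturbed three-particle system with collision time `Tc`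
(the case `δ = 0` is the unperturbed one). -/
def ThreePartPert (s γ δ : ℝ) (σ : ℝ → ℝ → ℝ) (X0 : Fin 3 → ℝ) (Tc : ℝ)
    (X : Fin 3 → ℝ → ℝ) : Prop :=
  (∀ i, X i 0 = X0 i - zeta i * δ) ∧
  (∀ i, ContinuousOn (X i) (Ico 0 Tc)) ∧
  (∀ i, ∀ t ∈ Ioo (0:ℝ) Tc,
    HasDerivAt (X i)
      (γ * ((∑ j ∈ Finset.univ.erase i,
          zeta i * zeta j * (X i t - X j t) / (2*s*|X i t - X j t| ^ (1+2*s)))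
        - zeta i * σ t (X i t) - zeta i * δ)) t) ∧
  (∀ t ∈ Ico (0:ℝ) Tc, X 0 t < X 1 t ∧ X 1 t < X 2 t) ∧
  Tendsto (fun t => min (X 1 t - X 0 t) (X 2 t - X 1 t)) (nhdsWithin Tc (Iio Tc)) (nhds 0)

/-- The corrector equation, together with the decay at infinity. -/
def CorrectorEqn (s η : ℝ) (W u ψ : ℝ → ℝ) : Prop :=
  (∀ x, fracLap s ψ x - deriv (deriv W) (u x) * ψ x
      = deriv u x + η * (deriv (deriv W) (u x) - deriv (deriv W) 0)) ∧
  Tendsto ψ atBot (nhds 0) ∧ Tendsto ψ atTop (nhds 0)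

/-- The layer problem (without regularity). -/
def LayerEqn (s : ℝ) (W u : ℝ → ℝ) : Prop :=
  (∀ x, fracLap s u x = deriv W (u x)) ∧ (∀ x, 0 < deriv u x) ∧
  Tendsto u atBot (nhds 0) ∧ Tendsto u atTop (nhds 1) ∧ u 0 = 1/2

/-- Membership in `C^{2,α}(ℝ)` for some `α ∈ (0,1)`. -/
def C2Holder (u : ℝ → ℝ) : Prop :=
  ContDiff ℝ 2 u ∧ ∃ C r : NNReal, 0 < (r : ℝ) ∧ (r : ℝ) < 1 ∧ HolderWith C r (iteratedDeriv 2 u)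

def heaviside (x : ℝ) : ℝ := if 0 < x then 1 else 0

/-- The barrier `v̄_ε` for the two-particle system, where the velocities `c̄ᵢ = ẋ̄ᵢ`
are expressed through the right-hand side of the ODE system. -/
def vbar2 (s γ ε δ β : ℝ) (u ψ : ℝ → ℝ) (σ : ℝ → ℝ → ℝ) (x1 x2 : ℝ → ℝ) (t x : ℝ) : ℝ :=
  ε ^ (2*s) * (σ t x + δ) / β + u ((x - x1 t)/ε) + u ((x2 t - x)/ε) - 1
    - ε ^ (2*s) * (γ * (1/(2*s*(x2 t - x1 t) ^ (2*s)) - σ t (x1 t) - δ)) * ψ ((x - x1 t)/ε)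
    + ε ^ (2*s) * (γ * (-(1/(2*s*(x2 t - x1 t) ^ (2*s))) + σ t (x2 t) + δ)) * ψ ((x2 t - x)/ε)

/-- The barrier `v̄_ε` for the three-particle system, where the velocities `c̄ᵢ = ẋ̄ᵢ`
are expressed through the right-hand side of the ODE system. -/
def vbar3 (s γ ε δ β : ℝ) (u ψ : ℝ → ℝ) (σ : ℝ → ℝ → ℝ) (X : Fin 3 → ℝ → ℝ) (t x : ℝ) : ℝ :=
  ε ^ (2*s) * (σ t x + δ) / β + (∑ i, u (zeta i * (x - X i t)/ε)) - 1
    - ∑ i, zeta i * ε ^ (2*s)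
        * (γ * ((∑ j ∈ Finset.univ.erase i,
            zeta i * zeta j * (X i t - X j t) / (2*s*|X i t - X j t| ^ (1+2*s)))
          - zeta i * σ t (X i t) - zeta i * δ))
        * ψ (zeta i * (x - X i t)/ε)

/-- The hat system for two particles, solved on `[0,T]` with prescribed initial data. -/
def HatSys2 (s γ δ : ℝ) (σ : ℝ → ℝ → ℝ) (a b T : ℝ) (x1 x2 : ℝ → ℝ) : Prop :=
  x1 0 = a ∧ x2 0 = b ∧
  ContinuousOn x1 (Icc 0 T) ∧ ContinuousOn x2 (Icc 0 T) ∧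
  (∀ t ∈ Ioo (0:ℝ) T,
    HasDerivAt x1 (γ * (1/(2*s*(x2 t - x1 t) ^ (2*s)) - σ t (x1 t) - δ)) t ∧
    HasDerivAt x2 (γ * (-(1/(2*s*(x2 t - x1 t) ^ (2*s))) + σ t (x2 t) + δ)) t) ∧
  (∀ t ∈ Icc (0:ℝ) T, x1 t < x2 t)

/-- The hat system for three particles, solved on `[0,T]` with prescribed initial data. -/
def HatSys3 (s γ δ : ℝ) (σ : ℝ → ℝ → ℝ) (a : Fin 3 → ℝ) (T : ℝ) (X : Fin 3 → ℝ → ℝ) : Prop :=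
  (∀ i, X i 0 = a i) ∧
  (∀ i, ContinuousOn (X i) (Icc 0 T)) ∧
  (∀ i, ∀ t ∈ Ioo (0:ℝ) T,
    HasDerivAt (X i)
      (γ * ((∑ j ∈ Finset.univ.erase i,
          zeta i * zeta j * (X i t - X j t) / (2*s*|X i t - X j t| ^ (1+2*s)))
        - zeta i * σ t (X i t) - zeta i * δ)) t) ∧
  (∀ t ∈ Icc (0:ℝ) T, X 0 t < X 1 t ∧ X 1 t < X 2 t)

/-- The supersolution barrier used after collision in the three-particle case. -/
def hsup (s ε μ K ρ y : ℝ) (u : ℝ → ℝ) (t x : ℝ) : ℝ :=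
  u ((x - (y + K * ρ * (Real.exp (-μ * t / ε ^ (2*s+1)) - 1)))/ε)
    + ρ * Real.exp (-μ * t / ε ^ (2*s+1))

end

/-- Lipschitz functions solving the integral equation `Y' = F (t, Y (t - h))` with a delay. -/
theorem exists_delayed_integral_solution {E : Type*} [NormedAddCommGroup E] [NormedSpace ℝ E]
    [CompleteSpace E] {F : ℝ → E → E} (hF : Continuous (Function.uncurry F)) {B : NNReal}
    (hB : ∀ t x, ‖F t x‖ ≤ B) (x₀ : E) (T : ℝ) {h : ℝ} (hh : 0 < h) :
    ∃ Y : ℝ → E, LipschitzWith B Y ∧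
      ∀ t ∈ Icc 0 T, Y t = x₀ + ∫ τ in (0:ℝ)..t, F τ (Y (τ - h)) := by
  let step : (ℝ → E) → ℝ → E := fun Y t => x₀ + ∫ τ in (0:ℝ)..(max t 0), F τ (Y (τ - h))
  let G : ℕ → ℝ → E := fun k => step^[k] fun _ => x₀
  have hsucc : ∀ k t, G (k + 1) t = x₀ + ∫ τ in (0:ℝ)..(max t 0), F τ (G k (τ - h)) := by
    intro k t
    simp only [G, Function.iterate_succ_apply']
    rfl
  have hlip : ∀ k, LipschitzWith B (G k) := by
    intro k
    induction k with
    | zero => exact (LipschitzWith.const x₀).weaken (zero_le)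
    | succ k ih =>
      have hc : Continuous fun τ => F τ (G k (τ - h)) :=
        hF.comp₂ continuous_id (ih.continuous.comp (by fun_prop))
      refine LipschitzWith.of_dist_le_mul fun a b => ?_
      rw [dist_eq_norm, hsucc, hsucc, add_sub_add_left_eq_sub,
        intervalIntegral.integral_interval_sub_left (hc.intervalIntegrable _ _)
          (hc.intervalIntegrable _ _)]
      refine (intervalIntegral.norm_integral_le_of_norm_le_const fun x _ => hB _ _).trans ?_
      rw [Real.dist_eq]
      exact mul_le_mul_of_nonneg_left (abs_max_sub_max_le_abs a b 0) B.2
  have hstab : ∀ k : ℕ, ∀ t ≤ k * h, G (k + 1) t = G k t := by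
    intro k
    induction k with
    | zero =>
      intro t ht
      rw [hsucc, max_eq_right (by simpa using ht)]
      simp [G]
    | succ k ih =>
      intro t ht
      rw [hsucc, hsucc]
      congr 1
      refine intervalIntegral.integral_congr fun τ hτ => ?_
      rw [uIcc_of_le (le_max_right _ _)] at hτ
      have : τ ≤ (k + 1 : ℕ) * h := hτ.2.trans (max_le ht (by positivity))
      have hle : τ - h ≤ k * h := by
        push_cast at this
        linarith
      exact congrArg (F τ) (ih _ hle)
  obtain ⟨k, hk⟩ := exists_nat_ge (T / h)
  refine ⟨G k, hlip k, fun t ht => ?_⟩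
  rw [← hstab k t (ht.2.trans ((div_le_iff₀ hh).1 hk)), hsucc, max_eq_left ht.1]

/-- **Peano existence theorem** for a globally bounded continuous vector field. -/
theorem exists_hasDerivAt_of_continuous_of_bounded {E : Type*} [NormedAddCommGroup E]
    [NormedSpace ℝ E] [ProperSpace E] {F : ℝ → E → E} (hF : Continuous (Function.uncurry F))
    {B : NNReal} (hB : ∀ t x, ‖F t x‖ ≤ B) (x₀ : E) {T : ℝ} (hT : 0 ≤ T) :
    ∃ X : ℝ → E, X 0 = x₀ ∧ ∀ t ∈ Icc 0 T, HasDerivAt X (F t (X t)) t := by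
  have hpos : ∀ n : ℕ, (0:ℝ) < 1 / ((n:ℝ) + 1) := fun n => by positivity
  choose Y hYlip hY using fun n : ℕ => exists_delayed_integral_solution hF hB x₀ T (hpos n)
  let f : ℕ → BoundedContinuousFunction (Icc (0:ℝ) T) E := fun n =>
    BoundedContinuousFunction.mkOfCompact ⟨fun t => Y n t, (hYlip n).continuous.comp (by fun_prop)⟩
  have hf : ∀ n t, f n t = Y n t := fun n t => rfl
  have h0 : ∀ n, Y n 0 = x₀ := fun n => by simpa using hY n 0 ⟨le_rfl, hT⟩
  have hcomp : IsCompact (closure (range f)) := by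
    refine BoundedContinuousFunction.arzela_ascoli (Metric.closedBall x₀ (B * T))
      (isCompact_closedBall _ _) _ ?_ ?_
    · rintro _ t ⟨n, rfl⟩
      rw [hf, Metric.mem_closedBall, ← h0 n]
      refine ((hYlip n).dist_le_mul _ _).trans (mul_le_mul_of_nonneg_left ?_ B.2)
      rw [Real.dist_eq, sub_zero, abs_of_nonneg t.2.1]
      exact t.2.2
    · refine UniformEquicontinuous.equicontinuous ?_
      refine LipschitzWith.uniformEquicontinuous _ B ?_
      rintro ⟨_, n, rfl⟩
      have := (hYlip n).comp (LipschitzWith.subtype_val (Icc (0:ℝ) T))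
      rwa [mul_one] at this
  obtain ⟨g, -, φ, hφ, hlim⟩ :=
    hcomp.tendsto_subseq (x := f) fun n => subset_closure (mem_range_self n)
  have hpt : ∀ t (ht : t ∈ Icc 0 T), Tendsto (fun n => Y (φ n) t) atTop (nhds (g ⟨t, ht⟩)) := by
    intro t ht
    exact ((continuous_eval_const (⟨t, ht⟩ : Icc (0:ℝ) T)).tendsto g).comp hlim
  have hshift : ∀ t (ht : t ∈ Icc 0 T),
      Tendsto (fun n => Y (φ n) (t - 1 / ((φ n : ℝ) + 1))) atTop (nhds (g ⟨t, ht⟩)) := by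
    intro t ht
    refine tendsto_of_tendsto_of_dist (hpt t ht) ?_
    have h1 : Tendsto (fun n : ℕ => (B:ℝ) * (1 / ((φ n : ℝ) + 1))) atTop (nhds 0) := by
      simpa using (tendsto_one_div_add_atTop_nhds_zero_nat.comp hφ.tendsto_atTop).const_mul (B:ℝ)
    refine squeeze_zero (fun _ => dist_nonneg) (fun n => ?_) h1
    refine ((hYlip _).dist_le_mul _ _).trans (le_of_eq ?_)
    rw [Real.dist_eq, sub_sub_cancel, abs_of_pos (hpos _)]
  let Z : ℝ → E := IccExtend hT g
  have hZ : ∀ t (ht : t ∈ Icc 0 T), Z t = g ⟨t, ht⟩ := fun t ht => IccExtend_of_mem hT g ht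
  have hZc : Continuous Z := g.continuous.Icc_extend'
  have hFZ : Continuous fun τ => F τ (Z τ) := hF.comp₂ continuous_id hZc
  let X : ℝ → E := fun t => x₀ + ∫ τ in (0:ℝ)..t, F τ (Z τ)
  have hXZ : ∀ t ∈ Icc 0 T, X t = Z t := by
    intro t ht
    refine tendsto_nhds_unique ?_ ((hZ t ht).symm ▸ hpt t ht)
    simp_rw [fun n => hY (φ n) t ht]
    refine Tendsto.const_add _ ?_
    refine intervalIntegral.tendsto_integral_filter_of_dominated_convergence (fun _ => (B:ℝ))
      (.of_forall fun n => ?_) (.of_forall fun n => .of_forall fun τ _ => hB _ _)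
      intervalIntegrable_const (.of_forall fun τ hτ => ?_)
    · exact (hF.comp₂ continuous_id ((hYlip _).continuous.comp
        (continuous_id.sub continuous_const))).aestronglyMeasurable
    · rw [uIoc_of_le ht.1] at hτ
      have hτ' : τ ∈ Icc 0 T := ⟨hτ.1.le, hτ.2.trans ht.2⟩
      have h2 := hshift τ hτ'
      rw [← hZ] at h2
      exact (hF.tendsto (τ, Z τ)).comp (tendsto_const_nhds.prodMk_nhds h2)
  refine ⟨X, by simp [X], fun t ht => ?_⟩
  rw [hXZ t ht]
  exact (intervalIntegral.integral_hasDerivAt_right (hFZ.intervalIntegrable _ _)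
    (hFZ.stronglyMeasurableAtFilter _ _) hFZ.continuousAt).const_add _

/-- A lower bound on the derivative on `[0, T]` bounds the increments from below. -/
theorem mul_sub_le_of_hasDerivAt_Icc {f f' : ℝ → ℝ} {C T : ℝ}
    (hf : ∀ t ∈ Icc 0 T, HasDerivAt f (f' t) t) (hC : ∀ t ∈ Icc 0 T, C ≤ f' t)
    {t t' : ℝ} (ht : t ∈ Icc 0 T) (ht' : t' ∈ Icc 0 T) (h : t ≤ t') :
    C * (t' - t) ≤ f t' - f t := by
  refine (convex_Icc 0 T).mul_sub_le_image_sub_of_le_deriv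
    (fun u hu => (hf u hu).continuousAt.continuousWithinAt)
    (fun u hu => (hf u (interior_subset hu)).differentiableAt.differentiableWithinAt)
    (fun u hu => ?_) t ht t' ht' h
  rw [(hf u (interior_subset hu)).deriv]
  exact hC u (interior_subset hu)

/-- Three particles, the middle one of opposite orientation, with a decreasing interaction
potential `w`: if the right gap is initially large compared to the left one, then the system has a
solution on a short time interval along which the left gap decreases but stays comparable to its
initial value `L`, while the right gap stays above `L`. -/
theorem exists_three_particle_solution {w : ℝ → ℝ} {σ : ℝ → ℝ → ℝ} {q L γ S δ T a b c : ℝ}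
    (hwc : ContinuousOn w (Ioi 0)) (hwa : AntitoneOn w (Ioi 0)) (hwp : ∀ r > 0, 0 < w r)
    (hq : 1 < q) (hw2 : ∀ r > 0, w (2 * r) = w r / q) (hL : 0 < L) (hγ : 0 < γ)
    (hσc : Continuous fun p : ℝ × ℝ => σ (max p.1 0) p.2) (hS : ∀ t x : ℝ, 0 ≤ t → |σ t x| ≤ S)
    (hδ : δ ∈ Ioc (0:ℝ) 1) (hT : 0 ≤ T) (hsmall : 4 * (S + 1) ≤ (1 - 1 / q) * w L)
    (hdrop : γ * (2 * q * w L + 2 * (S + 1)) * T ≤ L / 2) (hab : b - a = L)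
    (hbc : 3 / 2 * L ≤ c - b) :
    ∃ x y z : ℝ → ℝ, x 0 = a ∧ y 0 = b ∧ z 0 = c ∧
      (∀ t ∈ Icc 0 T,
        HasDerivAt x (γ * (w (y t - x t) - w (z t - x t) - σ t (x t) - δ)) t ∧
        HasDerivAt y (γ * (-w (y t - x t) + w (z t - y t) + σ t (y t) + δ)) t ∧
        HasDerivAt z (γ * (w (z t - x t) - w (z t - y t) - σ t (z t) - δ)) t) ∧
      (∀ t ∈ Icc 0 T, L / 2 ≤ y t - x t ∧ y t - x t ≤ L ∧ L ≤ z t - y t) ∧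
      (∀ t ∈ Icc 0 T, ∀ t' ∈ Icc 0 T, t < t' → y t' - x t' < y t - x t) ∧
      γ * ((1 - 1 / q) * w L - (S + δ)) * T ≤ x T - a := by
  obtain ⟨hδ0, hδ1⟩ := hδ
  have hS0 : 0 ≤ S := (abs_nonneg _).trans (hS 0 0 le_rfl)
  have hq0 : 0 < q := by linarith
  have hwL : 0 < w L := hwp L hL
  have hwhalf : w (L / 2) = q * w L := by
    have := hw2 (L / 2) (by positivity)
    rw [mul_div_cancel₀ L (two_ne_zero)] at this
    rw [this]
    field_simp
  let m₁ : (Fin 3 → ℝ) → ℝ := fun X => max (L / 2) (min (X 1 - X 0) L)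
  let m₂ : (Fin 3 → ℝ) → ℝ := fun X => max L (X 2 - X 1)
  have hm₁c : Continuous m₁ := by fun_prop
  have hm₂c : Continuous m₂ := by fun_prop
  have hm₁l : ∀ X, L / 2 ≤ m₁ X := fun X => le_max_left _ _
  have hm₁u : ∀ X, m₁ X ≤ L := fun X => max_le (by linarith) (min_le_right _ _)
  have hm₂l : ∀ X, L ≤ m₂ X := fun X => le_max_left _ _
  have hm₁p : ∀ X, 0 < m₁ X := fun X => by linarith [hm₁l X]
  have hm₂p : ∀ X, 0 < m₂ X := fun X => by linarith [hm₂l X]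
  have hm₃p : ∀ X, 0 < m₁ X + m₂ X := fun X => add_pos (hm₁p X) (hm₂p X)
  have hw₁c : Continuous fun X => w (m₁ X) := hwc.comp_continuous hm₁c hm₁p
  have hw₂c : Continuous fun X => w (m₂ X) := hwc.comp_continuous hm₂c hm₂p
  have hw₃c : Continuous fun X => w (m₁ X + m₂ X) := hwc.comp_continuous (hm₁c.add hm₂c) hm₃p
  have hw₁u : ∀ X, w (m₁ X) ≤ q * w L := fun X =>
    hwhalf ▸ hwa (half_pos hL) (hm₁p X) (hm₁l X)
  have hw₁l : ∀ X, w L ≤ w (m₁ X) := fun X => hwa (hm₁p X) hL (hm₁u X)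
  have hw₂u : ∀ X, w (m₂ X) ≤ w L := fun X => hwa hL (hm₂p X) (hm₂l X)
  have hw₃u : ∀ X, w (m₁ X + m₂ X) ≤ w (m₁ X) / q := fun X => by
    rw [← hw2 _ (hm₁p X)]
    exact hwa (mul_pos two_pos (hm₁p X)) (hm₃p X) (by linarith [hm₁u X, hm₂l X])
  have hw₃p : ∀ X, 0 < w (m₁ X + m₂ X) := fun X => hwp _ (hm₃p X)
  have hw₂₁ : ∀ X, w (m₂ X) ≤ w (m₁ X) := fun X => (hw₂u X).trans (hw₁l X)
  have hgap : ∀ X, (1 - 1 / q) * w L ≤ w (m₁ X) - w (m₁ X + m₂ X) := fun X => by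
    have h1 : 0 ≤ 1 - 1 / q := by
      rw [sub_nonneg, div_le_one hq0]
      exact hq.le
    have h2 := mul_le_mul_of_nonneg_left (hw₁l X) h1
    have h3 : (1 - 1 / q) * w (m₁ X) = w (m₁ X) - w (m₁ X) / q := by ring
    linarith [hw₃u X]
  have hwLq : w L ≤ q * w L := le_mul_of_one_le_left hwL.le hq.le
  have hσb : ∀ t x : ℝ, |σ (max t 0) x| ≤ S := fun t x => hS _ _ (le_max_right _ _)
  let F : ℝ → (Fin 3 → ℝ) → Fin 3 → ℝ := fun t X =>
    ![γ * (w (m₁ X) - w (m₁ X + m₂ X) - σ (max t 0) (X 0) - δ),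
      γ * (-w (m₁ X) + w (m₂ X) + σ (max t 0) (X 1) + δ),
      γ * (w (m₁ X + m₂ X) - w (m₂ X) - σ (max t 0) (X 2) - δ)]
  have hσi : ∀ i : Fin 3, Continuous fun p : ℝ × (Fin 3 → ℝ) => σ (max p.1 0) (p.2 i) := fun i =>
    hσc.comp (continuous_fst.prodMk ((continuous_apply i).comp continuous_snd))
  have hFc : Continuous (Function.uncurry F) := by
    have h1 := hw₁c.comp (continuous_snd (X := ℝ))
    have h2 := hw₂c.comp (continuous_snd (X := ℝ))
    have h3 := hw₃c.comp (continuous_snd (X := ℝ))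
    refine continuous_pi fun i => ?_
    fin_cases i
    · exact continuous_const.mul (((h1.sub h3).sub (hσi 0)).sub continuous_const)
    · exact continuous_const.mul (((h1.neg.add h2).add (hσi 1)).add continuous_const)
    · exact continuous_const.mul (((h3.sub h2).sub (hσi 2)).sub continuous_const)
  let B : NNReal := ⟨γ * (q * w L + S + 1), by positivity⟩
  have hFB : ∀ t X, ‖F t X‖ ≤ B := by
    intro t X
    have hσX := fun i : Fin 3 => abs_le.1 (hσb t (X i))
    have hmul : ∀ r : ℝ, |r| ≤ q * w L + S + 1 → ‖γ * r‖ ≤ B := fun r hr => by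
      rw [norm_mul, Real.norm_of_nonneg hγ.le]
      exact mul_le_mul_of_nonneg_left hr hγ.le
    have h1 := hw₁u X
    have h2 := hw₂₁ X
    have h3 := hwp _ (hm₂p X)
    have h4 := hw₃p X
    have h5 : w (m₁ X + m₂ X) ≤ w (m₂ X) :=
      hwa (hm₂p X) (hm₃p X) (by linarith [hm₁p X])
    refine (pi_norm_le_iff_of_nonneg B.2).2 fun i => ?_
    fin_cases i
    · refine hmul _ (abs_le.2 ⟨?_, ?_⟩) <;> linarith [(hσX 0).1, (hσX 0).2]
    · refine hmul _ (abs_le.2 ⟨?_, ?_⟩) <;> linarith [(hσX 1).1, (hσX 1).2]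
    · refine hmul _ (abs_le.2 ⟨?_, ?_⟩) <;> linarith [(hσX 2).1, (hσX 2).2]
  obtain ⟨X, hX0, hX⟩ := exists_hasDerivAt_of_continuous_of_bounded hFc hFB ![a, b, c] hT
  have hXi : ∀ i : Fin 3, ∀ t ∈ Icc 0 T, HasDerivAt (fun t => X t i) (F t (X t) i) t :=
    fun i t ht => hasDerivAt_pi.1 (hX t ht) i
  have hx0 : X 0 0 = a := by rw [hX0]; rfl
  have hy0 : X 0 1 = b := by rw [hX0]; rfl
  have hz0 : X 0 2 = c := by rw [hX0]; rfl
  have hx : ∀ t ∈ Icc 0 T, HasDerivAt (fun t => X t 0)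
    (γ * (w (m₁ (X t)) - w (m₁ (X t) + m₂ (X t)) - σ (max t 0) (X t 0) - δ)) t := hXi 0
  have hy : ∀ t ∈ Icc 0 T, HasDerivAt (fun t => X t 1)
    (γ * (-w (m₁ (X t)) + w (m₂ (X t)) + σ (max t 0) (X t 1) + δ)) t := hXi 1
  have hz : ∀ t ∈ Icc 0 T, HasDerivAt (fun t => X t 2)
    (γ * (w (m₁ (X t) + m₂ (X t)) - w (m₂ (X t)) - σ (max t 0) (X t 2) - δ)) t := hXi 2
  have hd₁ := fun t ht => (hy t ht).sub (hx t ht)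
  have hd₂ := fun t ht => (hz t ht).sub (hy t ht)
  have h0T : (0:ℝ) ∈ Icc 0 T := ⟨le_rfl, hT⟩
  have hanti : ∀ t ∈ Icc 0 T, ∀ t' ∈ Icc 0 T, t < t' → X t' 1 - X t' 0 < X t 1 - X t 0 := by
    intro t ht t' ht' htt
    have := mul_sub_le_of_hasDerivAt_Icc (fun t ht => (hd₁ t ht).neg) (C := γ) (fun u hu => ?_)
      ht ht' htt.le
    · simp only [Pi.neg_apply, Pi.sub_apply] at this
      nlinarith [mul_pos hγ (sub_pos.2 htt)]
    · rw [← mul_sub, ← mul_neg]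
      refine le_mul_of_one_le_right hγ.le ?_
      linarith [hgap (X u), hw₂₁ (X u), hw₂u (X u), hw₁l (X u), (abs_le.1 (hσb u (X u 0))).2,
        (abs_le.1 (hσb u (X u 1))).2]
  have hbound : ∀ t ∈ Icc 0 T, γ * (2 * q * w L + 2 * (S + 1)) * t ≤ L / 2 := fun t ht =>
    (mul_le_mul_of_nonneg_left ht.2 (by positivity)).trans hdrop
  have hreg : ∀ t ∈ Icc 0 T,
      L / 2 ≤ X t 1 - X t 0 ∧ X t 1 - X t 0 ≤ L ∧ L ≤ X t 2 - X t 1 := by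
    intro t ht
    refine ⟨?_, ?_, ?_⟩
    · have := mul_sub_le_of_hasDerivAt_Icc hd₁ (C := γ * -(2 * q * w L + 2 * (S + 1)))
        (fun u hu => ?_) h0T ht ht.1
      · simp only [Pi.sub_apply, hx0, hy0] at this
        linarith [hbound t ht]
      · rw [← mul_sub]
        refine mul_le_mul_of_nonneg_left ?_ hγ.le
        linarith [hw₁u (X u), hw₃p (X u), hwp _ (hm₂p (X u)), (abs_le.1 (hσb u (X u 0))).1,
          (abs_le.1 (hσb u (X u 1))).1]
    · rcases ht.1.eq_or_lt with h | h
      · rw [← h, hx0, hy0, hab]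
      · have := hanti 0 h0T t ht h
        rw [hx0, hy0, hab] at this
        exact this.le
    · have := mul_sub_le_of_hasDerivAt_Icc hd₂ (C := γ * -(2 * q * w L + 2 * (S + 1)))
        (fun u hu => ?_) h0T ht ht.1
      · simp only [Pi.sub_apply, hy0, hz0] at this
        linarith [hbound t ht]
      · rw [← mul_sub]
        refine mul_le_mul_of_nonneg_left ?_ hγ.le
        linarith [hwp _ (hm₁p (X u)), hw₂u (X u), hw₃p (X u), (abs_le.1 (hσb u (X u 2))).2,
          (abs_le.1 (hσb u (X u 1))).2]
  refine ⟨fun t => X t 0, fun t => X t 1, fun t => X t 2, hx0, hy0, hz0, fun t ht => ?_, hreg,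
    hanti, ?_⟩
  · obtain ⟨h1, h2, h3⟩ := hreg t ht
    have e1 : m₁ (X t) = X t 1 - X t 0 := by
      simp only [m₁, min_eq_left h2, max_eq_right h1]
    have e2 : m₂ (X t) = X t 2 - X t 1 := max_eq_right h3
    have e3 : m₁ (X t) + m₂ (X t) = X t 2 - X t 0 := by
      rw [e1, e2]
      ring
    have hx' := hx t ht
    have hy' := hy t ht
    have hz' := hz t ht
    rw [max_eq_left ht.1] at hx' hy' hz'
    rw [e3] at hx' hz'
    rw [e1] at hx' hy'
    rw [e2] at hy' hz'
    exact ⟨hx', hy', hz'⟩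
  · have := mul_sub_le_of_hasDerivAt_Icc hx (C := γ * ((1 - 1 / q) * w L - (S + δ)))
      (fun u hu => ?_) h0T ⟨hT, le_rfl⟩ hT
    · simpa only [hx0, sub_zero] using this
    · refine mul_le_mul_of_nonneg_left ?_ hγ.le
      linarith [hgap (X u), (abs_le.1 (hσb u (X u 0))).2]

/-- The interaction force between two particles at distance `r`, without the redundant factor. -/
theorem div_two_mul_rpow_one_add {s r : ℝ} (hr : 0 < r) :
    r / (2 * s * r ^ (1 + 2 * s)) = 1 / (2 * s * r ^ (2 * s)) := by
  rw [Real.rpow_add hr, Real.rpow_one, mul_left_comm, div_mul_cancel_left₀ hr.ne', one_div]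

/-- The three-particle hat system in coordinates. -/
theorem HatSys3.of_coordinates {s γ δ T : ℝ} {σ : ℝ → ℝ → ℝ} {a : Fin 3 → ℝ} {x y z : ℝ → ℝ}
    (hx0 : x 0 = a 0) (hy0 : y 0 = a 1) (hz0 : z 0 = a 2)
    (hder : ∀ t ∈ Icc 0 T,
      HasDerivAt x (γ * (1 / (2 * s * (y t - x t) ^ (2 * s))
        - 1 / (2 * s * (z t - x t) ^ (2 * s)) - σ t (x t) - δ)) t ∧
      HasDerivAt y (γ * (-(1 / (2 * s * (y t - x t) ^ (2 * s)))
        + 1 / (2 * s * (z t - y t) ^ (2 * s)) + σ t (y t) + δ)) t ∧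
      HasDerivAt z (γ * (1 / (2 * s * (z t - x t) ^ (2 * s))
        - 1 / (2 * s * (z t - y t) ^ (2 * s)) - σ t (z t) - δ)) t)
    (hord : ∀ t ∈ Icc 0 T, x t < y t ∧ y t < z t) :
    HatSys3 s γ δ σ a T ![x, y, z] := by
  refine ⟨fun i => ?_, fun i t ht => ?_, fun i t ht => ?_, hord⟩
  · fin_cases i <;> assumption
  · obtain ⟨h1, h2, h3⟩ := hder t ht
    fin_cases i
    · exact h1.continuousAt.continuousWithinAt
    · exact h2.continuousAt.continuousWithinAt
    · exact h3.continuousAt.continuousWithinAt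
  · have ht' := Ioo_subset_Icc_self ht
    obtain ⟨h1, h2, h3⟩ := hder t ht'
    obtain ⟨hxy, hyz⟩ := hord t ht'
    have hxz := hxy.trans hyz
    have e0 : (Finset.univ.erase (0 : Fin 3)) = {1, 2} := by decide
    have e1 : (Finset.univ.erase (1 : Fin 3)) = {0, 2} := by decide
    have e2 : (Finset.univ.erase (2 : Fin 3)) = {0, 1} := by decide
    have hpos : ∀ {u v : ℝ}, u < v →
        (v - u) / (2 * s * |v - u| ^ (1 + 2 * s)) = 1 / (2 * s * (v - u) ^ (2 * s)) := by
      intro u v huv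
      rw [abs_of_pos (sub_pos.2 huv), div_two_mul_rpow_one_add (sub_pos.2 huv)]
    have hneg : ∀ {u v : ℝ}, u < v →
        (u - v) / (2 * s * |u - v| ^ (1 + 2 * s)) = -(1 / (2 * s * (v - u) ^ (2 * s))) := by
      intro u v huv
      rw [abs_sub_comm, ← hpos huv, ← neg_div, neg_sub]
    fin_cases i
    · change HasDerivAt x _ t
      convert h1 using 1
      simp only [Fin.zero_eta, Fin.isValue, e0]
      rw [Finset.sum_pair (by decide)]
      change γ * ((1 * -1 * (x t - y t) / (2 * s * |x t - y t| ^ (1 + 2 * s))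
        + 1 * 1 * (x t - z t) / (2 * s * |x t - z t| ^ (1 + 2 * s))) - 1 * σ t (x t) - 1 * δ) = _
      rw [mul_div_assoc, mul_div_assoc, hneg hxy, hneg hxz]
      ring
    · change HasDerivAt y _ t
      convert h2 using 1
      simp only [Fin.mk_one, Fin.isValue, e1]
      rw [Finset.sum_pair (by decide)]
      change γ * ((-1 * 1 * (y t - x t) / (2 * s * |y t - x t| ^ (1 + 2 * s))
        + -1 * 1 * (y t - z t) / (2 * s * |y t - z t| ^ (1 + 2 * s)))
          - -1 * σ t (y t) - -1 * δ) = _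
      rw [mul_div_assoc, mul_div_assoc, hpos hxy, hneg hyz]
      ring
    · change HasDerivAt z _ t
      convert h3 using 1
      simp only [Fin.reduceFinMk, Fin.isValue, e2]
      rw [Finset.sum_pair (by decide)]
      change γ * ((1 * 1 * (z t - x t) / (2 * s * |z t - x t| ^ (1 + 2 * s))
        + 1 * -1 * (z t - y t) / (2 * s * |z t - y t| ^ (1 + 2 * s))) - 1 * σ t (z t) - 1 * δ) = _
      rw [mul_div_assoc, mul_div_assoc, hpos hxz, hpos hyz]
      ring

theorem statement_18
    (s γ : ℝ) (hs : s ∈ Ioo (0:ℝ) 1) (hγ : 0 < γ)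
    (σ : ℝ → ℝ → ℝ) (hσ : SigmaOK s σ)
    (Sb : ℝ) (hSb0 : 0 ≤ Sb) (hSb : ∀ t x : ℝ, 0 ≤ t → |σ t x| ≤ Sb) :
    ∃ K M : ℝ, 1 < K ∧ 1 < M ∧ ∃ θ₀ > (0:ℝ),
      ∀ θ ∈ Ioo (0:ℝ) θ₀, ∀ δh ∈ Ioc (0:ℝ) 1, ∀ p₁ p₂ p₃ : ℝ,
        p₂ - p₁ = θ → M*θ ≤ p₃ - p₂ →
        ∀ tst : ℝ,
          tst = (2:ℝ) ^ (2*s+2) * s * (K+2) ^ (2*s) * θ ^ (2*s+1)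
              / (γ * ((2:ℝ) ^ (2*s) - 1
                  - (2:ℝ) ^ (2*s+1) * s * (K+2) ^ (2*s) * θ ^ (2*s) * (Sb + δh))) →
          ∃ X : Fin 3 → ℝ → ℝ,
            HatSys3 s γ δh σ ![p₁ - θ, p₂ + K*θ, p₃ - θ] tst X ∧
            (∀ t ∈ Icc (0:ℝ) tst, ∀ t' ∈ Icc (0:ℝ) tst, t < t' →
              X 1 t' - X 0 t' < X 1 t - X 0 t) ∧
            p₂ ≤ X 0 tst ∧
            (∀ t ∈ Icc (0:ℝ) tst, θ ≤ X 1 t - X 0 t ∧ X 1 t - X 0 t ≤ X 2 t - X 1 t) := by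
  have hs0 : 0 < s := hs.1
  have h2s : 0 < 2 * s := by positivity
  set q : ℝ := (2:ℝ) ^ (2 * s) with hqdef
  have hq : 1 < q := Real.one_lt_rpow one_lt_two h2s
  have hq1 : 0 < q - 1 := sub_pos.2 hq
  have hq0 : 0 < q := by linarith
  let w : ℝ → ℝ := fun r => 1 / (2 * s * r ^ (2 * s))
  have hwp : ∀ r > 0, 0 < w r := fun r hr => by
    have := Real.rpow_pos_of_pos hr (2 * s)
    positivity
  have hwc : ContinuousOn w (Ioi 0) := by
    intro r hr
    have hr0 : (0:ℝ) < r := hr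
    have := Real.rpow_pos_of_pos hr0 (2 * s)
    have hne : 2 * s * r ^ (2 * s) ≠ 0 := by positivity
    exact (continuousAt_const.div (continuousAt_const.mul
      (Real.continuousAt_rpow_const r _ (Or.inl hr0.ne'))) hne).continuousWithinAt
  have hwa : AntitoneOn w (Ioi 0) := by
    intro r hr r' _ hrr
    have hr0 : (0:ℝ) < r := hr
    have := Real.rpow_pos_of_pos hr0 (2 * s)
    exact one_div_le_one_div_of_le (by positivity) (mul_le_mul_of_nonneg_left
      (Real.rpow_le_rpow hr0.le hrr h2s.le) h2s.le)
  have hw2 : ∀ r > 0, w (2 * r) = w r / q := fun r hr => by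
    simp only [w]
    rw [Real.mul_rpow zero_le_two hr.le, ← hqdef, div_div]
    congr 1
    ring
  have hσc : Continuous fun p : ℝ × ℝ => σ (max p.1 0) p.2 :=
    hσ.ucont.continuousOn.comp_continuous (f := fun p : ℝ × ℝ => (max p.1 0, p.2))
      (by fun_prop) fun p => ⟨mem_Ici.2 (le_max_right _ _), mem_univ _⟩
  let K : ℝ := 16 * q ^ 2 / (q - 1) + 3
  have hKdef : 16 * q ^ 2 / (q - 1) + 3 = K := rfl
  have hK : 3 < K := by
    have : 0 < 16 * q ^ 2 / (q - 1) := by positivity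
    linarith
  clear_value K
  let c : ℝ := (1 - 1 / q) / (8 * s * (Sb + 1))
  have hcq : 0 < 1 - 1 / q := sub_pos.2 ((div_lt_one hq0).2 hq)
  have hc : 0 < c := by positivity
  refine ⟨K, 5 / 2 * K + 4, by linarith, by linarith, c ^ (2 * s)⁻¹ / (K + 2),
    div_pos (Real.rpow_pos_of_pos hc _) (by linarith), ?_⟩
  intro θ hθ δ hδ p₁ p₂ p₃ hp₁ hp₂ T hT
  obtain ⟨hθ0, hθ1⟩ := hθ
  have hK2 : 0 < K + 2 := by linarith
  set L : ℝ := (K + 2) * θ with hLdef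
  have hL : 0 < L := by positivity
  have hLc : L ^ (2 * s) ≤ c := by
    rw [lt_div_iff₀ hK2, mul_comm] at hθ1
    have := Real.rpow_le_rpow hL.le hθ1.le h2s.le
    rwa [← Real.rpow_mul hc.le, inv_mul_cancel₀ h2s.ne', Real.rpow_one] at this
  have hP : 0 < L ^ (2 * s) := Real.rpow_pos_of_pos hL _
  have hsmall : 4 * (Sb + 1) ≤ (1 - 1 / q) * w L := by
    rw [le_div_iff₀ (by positivity)] at hLc
    simp only [w]
    rw [mul_one_div, le_div_iff₀ (by positivity)]
    linarith
  obtain ⟨A, hA⟩ : ∃ A, A = (1 - 1 / q) * w L := ⟨_, rfl⟩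
  have hTv : T = 2 * θ / (γ * (A - (Sb + δ))) := by
    have e1 : (2:ℝ) ^ (2 * s + 2) = 4 * q := by
      rw [Real.rpow_add two_pos, ← hqdef, Real.rpow_two]
      ring
    have e2 : (2:ℝ) ^ (2 * s + 1) = 2 * q := by
      rw [Real.rpow_add two_pos, ← hqdef, Real.rpow_one]
      ring
    have e3 : θ ^ (2 * s + 1) = θ ^ (2 * s) * θ := by
      rw [Real.rpow_add hθ0, Real.rpow_one]
    have e4 : L ^ (2 * s) = (K + 2) ^ (2 * s) * θ ^ (2 * s) := Real.mul_rpow hK2.le hθ0.le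
    have e5 : A - (Sb + δ) =
        (q - 1 - 2 * q * s * L ^ (2 * s) * (Sb + δ)) / (2 * q * s * L ^ (2 * s)) := by
      rw [hA]
      simp only [w]
      field_simp
    rw [hT, e1, e2, e3, e5]
    have e6 : q - 1 - 2 * q * s * (K + 2) ^ (2 * s) * θ ^ (2 * s) * (Sb + δ) =
        q - 1 - 2 * q * s * L ^ (2 * s) * (Sb + δ) := by
      rw [e4]
      ring
    rw [e6, mul_div_assoc', div_div_eq_mul_div]
    congr 1
    rw [e4]
    ring
  have hA4 : 4 * (Sb + 1) ≤ A := hA ▸ hsmall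
  have hA0 : 0 < A := by linarith
  have hv : 3 / 4 * A ≤ A - (Sb + δ) := by linarith [hδ.2]
  have hv0 : 0 < A - (Sb + δ) := by linarith
  have hT0 : 0 ≤ T := by
    rw [hTv]
    positivity
  have hTmul : γ * (A - (Sb + δ)) * T = 2 * θ := by
    rw [hTv]
    field_simp
  have hdrop : γ * (2 * q * w L + 2 * (Sb + 1)) * T ≤ L / 2 := by
    have hwA : 2 * q * w L = 2 * q ^ 2 / (q - 1) * A := by
      rw [hA]
      field_simp
    have hγT : γ * T * A ≤ 8 / 3 * θ := by
      have := mul_le_mul_of_nonneg_left hv (mul_nonneg hγ.le hT0)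
      linarith
    have hR : 0 < 2 * q ^ 2 / (q - 1) := by positivity
    have hKR : K = 8 * (2 * q ^ 2 / (q - 1)) + 3 := by
      rw [← hKdef]
      ring
    calc γ * (2 * q * w L + 2 * (Sb + 1)) * T
        ≤ γ * (2 * q ^ 2 / (q - 1) * A + A / 2) * T := by
          rw [hwA]
          gcongr
          linarith
      _ = (2 * q ^ 2 / (q - 1) + 1 / 2) * (γ * T * A) := by ring
      _ ≤ (2 * q ^ 2 / (q - 1) + 1 / 2) * (8 / 3 * θ) := by gcongr
      _ ≤ L / 2 := by
          rw [hLdef, hKR]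
          nlinarith [mul_pos hR hθ0]
  obtain ⟨x, y, z, hx0, hy0, hz0, hder, hreg, hanti, hfin⟩ :=
    exists_three_particle_solution (a := p₁ - θ) (b := p₂ + K * θ) (c := p₃ - θ) hwc hwa hwp hq
      hw2 hL hγ hσc hSb hδ hT0 hsmall hdrop (by rw [hLdef]; linarith) (by rw [hLdef]; linarith)
  refine ⟨![x, y, z], HatSys3.of_coordinates hx0 hy0 hz0 hder fun t ht => ?_, hanti, ?_,
    fun t ht => ?_⟩
  · obtain ⟨h1, -, h3⟩ := hreg t ht
    exact ⟨by linarith, by linarith⟩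
  · rw [← hA, hTmul] at hfin
    change p₂ ≤ x T
    linarith
  · obtain ⟨h1, h2, h3⟩ := hreg t ht
    refine ⟨le_trans ?_ h1, h2.trans h3⟩
    rw [hLdef]
    nlinarith
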